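/- Let V₁,…,V_b be exchangeable nonnegative random variables summing to 1 almost surely with common marginal V satisfying b·E[V²] < 1. Let 𝓜₂⁰ be the space of probability distributions on ℝ with mean 0 and finite second moment, equipped with the Wasserstein-2 (Mallows) metric d₂. Define the operator T on 𝓜₂⁰ by: T(φ) is the law of Σ_{k=1}^b V_k Z^{(k)} + C(𝓥), where Z^{(1)},…,Z^{(b)} are i.i.d. with law φ, independent of 𝓥 = (V₁,…,V_b), and C(𝓥) = 1 + μ^{-1} Σ_{i=1}^b V_i ln V_i with μ = b·E[−V ln V], assuming E[C(𝓥)] = 0 and E[C(𝓥)²] < ∞. Then T is a contraction: d₂(T(φ), T(ψ)) ≤ √(b·E[V²]) · d₂(φ, ψ) for all φ, ψ ∈ 𝓜₂⁰. Consequently T has a unique fixed point in 𝓜₂⁰. -/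

import Mathlib

open MeasureTheory ProbabilityTheory
open scoped ENNReal

/-- The Mallows (Wasserstein-2) distance between two laws on `ℝ`, as an infimum of
`L²`-distances over couplings. -/
noncomputable def mallows2 (φ ψ : Measure ℝ) : ℝ :=
  sInf {r : ℝ | ∃ π : Measure (ℝ × ℝ), IsProbabilityMeasure π ∧
    π.map Prod.fst = φ ∧ π.map Prod.snd = ψ ∧
    r = (∫ p, (p.1 - p.2) ^ 2 ∂π) ^ (1/2 : ℝ)}

/-- The smoothing operator `T`: `T(φ)` is the law of `∑ₖ Vₖ Z⁽ᵏ⁾ + C(𝓥)` where the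
`Z⁽ᵏ⁾` are i.i.d. with law `φ`, independent of `𝓥 ∼ ρ`, and
`C(v) = 1 + μ⁻¹ ∑ᵢ vᵢ ln vᵢ`. -/
noncomputable def splitOp {b : ℕ} (ρ : Measure (Fin b → ℝ)) (μc : ℝ)
    (φ : Measure ℝ) : Measure ℝ :=
  (ρ.prod (Measure.pi fun _ : Fin b => φ)).map
    (fun vz => (∑ k, vz.1 k * vz.2 k) + (1 + μc⁻¹ * ∑ i, vz.1 i * Real.log (vz.1 i)))


section helpers

variable {b : ℕ} {ρ : Measure (Fin b → ℝ)} [IsProbabilityMeasure ρ]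
  {Ω : Type*} [MeasurableSpace Ω] {P : Measure Ω} [IsProbabilityMeasure P]

lemma hlp_coord_memLp {d : Ω → ℝ} (hd : MemLp d 2 P) (k : Fin b) :
    MemLp (fun z : Fin b → Ω => d (z k)) 2 (Measure.pi fun _ : Fin b => P) :=
  hd.comp_measurePreserving (measurePreserving_eval (fun _ : Fin b => P) k)

lemma hlp_coord_prod {d : Ω → ℝ} (hd : MemLp d 2 P) (k : Fin b) :
    MemLp (fun vz : (Fin b → ℝ) × (Fin b → Ω) => d (vz.2 k)) 2
      (ρ.prod (Measure.pi fun _ : Fin b => P)) :=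
  (hlp_coord_memLp hd k).comp_measurePreserving measurePreserving_snd

lemma hlp_ae_fst {p : (Fin b → ℝ) → Prop} (h : ∀ᵐ v ∂ρ, p v) :
    ∀ᵐ vz : (Fin b → ℝ) × (Fin b → Ω) ∂(ρ.prod (Measure.pi fun _ : Fin b => P)), p vz.1 :=
  (measurePreserving_fst (μ := ρ)
    (ν := Measure.pi fun _ : Fin b => P)).quasiMeasurePreserving.ae h

lemma hlp_term (hv : ∀ᵐ v ∂ρ, ∀ i, |v i| ≤ 1) {d : Ω → ℝ} (hd : MemLp d 2 P) (k : Fin b) :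
    MemLp (fun vz : (Fin b → ℝ) × (Fin b → Ω) => vz.1 k * d (vz.2 k)) 2
      (ρ.prod (Measure.pi fun _ : Fin b => P)) := by
  have h := hlp_coord_prod (ρ := ρ) hd k
  refine h.mono ?_ ?_
  · refine AEStronglyMeasurable.mul ?_ h.1
    exact Measurable.aestronglyMeasurable (by fun_prop)
  · filter_upwards [hlp_ae_fst (P := P) hv] with vz hvz
    rw [norm_mul]
    exact mul_le_of_le_one_left (norm_nonneg _) (hvz k)

lemma hlp_sum (hv : ∀ᵐ v ∂ρ, ∀ i, |v i| ≤ 1) {d : Ω → ℝ} (hd : MemLp d 2 P) :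
    MemLp (fun vz : (Fin b → ℝ) × (Fin b → Ω) => ∑ k, vz.1 k * d (vz.2 k)) 2
      (ρ.prod (Measure.pi fun _ : Fin b => P)) :=
  memLp_finsetSum _ fun k _ => hlp_term hv hd k

lemma hlp_mean (hv : ∀ᵐ v ∂ρ, ∀ i, |v i| ≤ 1) {d : Ω → ℝ} (hd : MemLp d 2 P)
    (h0 : ∫ ω, d ω ∂P = 0) :
    ∫ vz, ∑ k, vz.1 k * d (vz.2 k) ∂(ρ.prod (Measure.pi fun _ : Fin b => P)) = 0 := by
  rw [integral_finsetSum _ fun k _ => (hlp_term hv hd k).integrable (by norm_num)]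
  refine Finset.sum_eq_zero fun k _ => ?_
  rw [integral_prod_mul (fun v : Fin b → ℝ => v k) (fun z : Fin b → Ω => d (z k))]
  rw [integral_comp_eval (μ := fun _ : Fin b => P) (i := k) (f := d) hd.1, h0, mul_zero]

lemma hlp_cross {d : Ω → ℝ} (hd : MemLp d 2 P) (h0 : ∫ ω, d ω ∂P = 0) (i j : Fin b) :
    ∫ z, d (z i) * d (z j) ∂(Measure.pi fun _ : Fin b => P)
      = if i = j then ∫ ω, d ω ^ 2 ∂P else 0 := by
  split_ifs with h
  · subst h
    rw [← integral_comp_eval (μ := fun _ : Fin b => P) (i := i) (f := fun ω => d ω ^ 2)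
      (hd.1.pow 2)]
    simp only [sq]
  · have hI : iIndepFun (fun (i : Fin b) (z : Fin b → Ω) => d (z i))
        (Measure.pi fun _ : Fin b => P) :=
      iIndepFun_pi (X := fun _ => d) (fun _ => hd.1.aemeasurable)
    rw [(hI.indepFun h).integral_fun_mul_eq_mul_integral (hlp_coord_memLp hd i).1
      (hlp_coord_memLp hd j).1]
    rw [integral_comp_eval (μ := fun _ : Fin b => P) (i := i) (f := d) hd.1, h0, zero_mul]

lemma hlp_sq (hv : ∀ᵐ v ∂ρ, ∀ i, |v i| ≤ 1) {d : Ω → ℝ} (hd : MemLp d 2 P)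
    (h0 : ∫ ω, d ω ∂P = 0) :
    ∫ vz, (∑ k, vz.1 k * d (vz.2 k)) ^ 2 ∂(ρ.prod (Measure.pi fun _ : Fin b => P))
      = (∑ k, ∫ v, v k ^ 2 ∂ρ) * ∫ ω, d ω ^ 2 ∂P := by
  have hint : ∀ i j : Fin b, Integrable (fun vz : (Fin b → ℝ) × (Fin b → Ω) =>
      (vz.1 i * d (vz.2 i)) * (vz.1 j * d (vz.2 j)))
      (ρ.prod (Measure.pi fun _ : Fin b => P)) := fun i j =>
    (hlp_term hv hd i).integrable_mul (hlp_term hv hd j)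
  simp only [sq (Finset.sum _ _), Finset.sum_mul_sum]
  rw [integral_finsetSum _ fun i _ => integrable_finsetSum _ fun j _ => hint i j, Finset.sum_mul]
  refine Finset.sum_congr rfl fun i _ => ?_
  rw [integral_finsetSum _ fun j _ => hint i j]
  have : ∀ j : Fin b, ∫ vz, (vz.1 i * d (vz.2 i)) * (vz.1 j * d (vz.2 j))
      ∂(ρ.prod (Measure.pi fun _ : Fin b => P))
      = (∫ v, v i * v j ∂ρ) * (if i = j then ∫ ω, d ω ^ 2 ∂P else 0) := by
    intro j
    rw [← hlp_cross hd h0 i j, ← integral_prod_mul (fun v : Fin b → ℝ => v i * v j)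
      (fun z : Fin b → Ω => d (z i) * d (z j))]
    congr 1; ext vz; ring
  simp only [this]
  simp [sq]

lemma hlp_splitOp_map (μc : ℝ) {X : Ω → ℝ} (hX : Measurable X) :
    splitOp ρ μc (P.map X) = (ρ.prod (Measure.pi fun _ : Fin b => P)).map
      (fun vz => (∑ k, vz.1 k * X (vz.2 k)) +
        (1 + μc⁻¹ * ∑ i, vz.1 i * Real.log (vz.1 i))) := by
  have : IsProbabilityMeasure (P.map X) := Measure.isProbabilityMeasure_map hX.aemeasurable
  unfold splitOp
  rw [← Measure.pi_map_pi (μ := fun _ : Fin b => P) (f := fun _ => X) (fun _ => hX.aemeasurable)]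
  have : IsProbabilityMeasure ((Measure.pi fun _ : Fin b => P).map (fun x i => X (x i))) :=
    Measure.isProbabilityMeasure_map (Measurable.aemeasurable (by fun_prop))
  conv_lhs => rw [← Measure.map_id (μ := ρ)]
  rw [Measure.map_prod_map _ _ measurable_id (by fun_prop), Measure.map_map (by fun_prop) (by fun_prop)]
  rfl

lemma hlp_C_meas (μc : ℝ) :
    Measurable (fun v : Fin b → ℝ => 1 + μc⁻¹ * ∑ i, v i * Real.log (v i)) := by fun_prop

lemma hlp_full (hv : ∀ᵐ v ∂ρ, ∀ i, |v i| ≤ 1) {μc : ℝ}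
    (hC2 : Integrable (fun v => (1 + μc⁻¹ * ∑ i, v i * Real.log (v i)) ^ 2) ρ)
    {d : Ω → ℝ} (hd : MemLp d 2 P) :
    MemLp (fun vz : (Fin b → ℝ) × (Fin b → Ω) => (∑ k, vz.1 k * d (vz.2 k)) +
        (1 + μc⁻¹ * ∑ i, vz.1 i * Real.log (vz.1 i))) 2
      (ρ.prod (Measure.pi fun _ : Fin b => P)) := by
  refine (hlp_sum hv hd).add ?_
  have : MemLp (fun v : Fin b → ℝ => 1 + μc⁻¹ * ∑ i, v i * Real.log (v i)) 2 ρ :=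
    (memLp_two_iff_integrable_sq (hlp_C_meas μc).aestronglyMeasurable).2 hC2
  exact this.comp_measurePreserving measurePreserving_fst

lemma hlp_full_mean (hv : ∀ᵐ v ∂ρ, ∀ i, |v i| ≤ 1) {μc : ℝ}
    (hC2 : Integrable (fun v => (1 + μc⁻¹ * ∑ i, v i * Real.log (v i)) ^ 2) ρ)
    (hC : ∫ v, (1 + μc⁻¹ * ∑ i, v i * Real.log (v i)) ∂ρ = 0)
    {d : Ω → ℝ} (hd : MemLp d 2 P) (h0 : ∫ ω, d ω ∂P = 0) :
    ∫ vz, ((∑ k, vz.1 k * d (vz.2 k)) +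
        (1 + μc⁻¹ * ∑ i, vz.1 i * Real.log (vz.1 i)))
      ∂(ρ.prod (Measure.pi fun _ : Fin b => P)) = 0 := by
  have hm : MemLp (fun v : Fin b → ℝ => 1 + μc⁻¹ * ∑ i, v i * Real.log (v i)) 2 ρ :=
    (memLp_two_iff_integrable_sq (hlp_C_meas μc).aestronglyMeasurable).2 hC2
  have hm2 : MemLp (fun vz : (Fin b → ℝ) × (Fin b → Ω) =>
      1 + μc⁻¹ * ∑ i, vz.1 i * Real.log (vz.1 i)) 2 (ρ.prod (Measure.pi fun _ : Fin b => P)) :=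
    hm.comp_measurePreserving
      (measurePreserving_fst (μ := ρ) (ν := Measure.pi fun _ : Fin b => P))
  rw [integral_add ((hlp_sum hv hd).integrable (by norm_num)) (hm2.integrable (by norm_num)),
    hlp_mean hv hd h0, zero_add]
  rw [integral_fun_fst (μ := ρ) (ν := Measure.pi fun _ : Fin b => P)
    (f := fun v : Fin b → ℝ => 1 + μc⁻¹ * ∑ i, v i * Real.log (v i)), hC, smul_zero]

/-- the identity for L2 norms -/
lemma hlp_norm_sq (f g : Lp ℝ 2 P) : ‖f - g‖ ^ 2 = ∫ ω, (f ω - g ω) ^ 2 ∂P := by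
  rw [← real_inner_self_eq_norm_sq, L2.inner_def]
  refine integral_congr_ae ?_
  filter_upwards [Lp.coeFn_sub f g] with ω h
  rw [h]
  simp [sq]

lemma hlp_fixed (hv : ∀ᵐ v ∂ρ, ∀ i, |v i| ≤ 1) {μc : ℝ}
    (hC2 : Integrable (fun v => (1 + μc⁻¹ * ∑ i, v i * Real.log (v i)) ^ 2) ρ)
    (hC : ∫ v, (1 + μc⁻¹ * ∑ i, v i * Real.log (v i)) ∂ρ = 0)
    (hc : (∑ k, ∫ v, v k ^ 2 ∂ρ) < 1) :
    ∃ φ : Measure ℝ, (IsProbabilityMeasure φ ∧ (∫ x, x ∂φ) = 0 ∧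
      Integrable (fun x : ℝ => x ^ 2) φ) ∧ splitOp ρ μc φ = φ := by
  obtain ⟨Φ, hΦ, hmap⟩ := Measure.exists_measurable_map_eq
    (ρ.prod (Measure.pi fun _ : Fin b => (volume : Measure unitInterval)))
  have hMP : MeasurePreserving Φ volume
    (ρ.prod (Measure.pi fun _ : Fin b => (volume : Measure unitInterval))) := ⟨hΦ, hmap⟩
  let F : Lp ℝ 2 (volume : Measure unitInterval) →
      (Fin b → ℝ) × (Fin b → unitInterval) → ℝ := fun f vz =>
    (∑ k, vz.1 k * f (vz.2 k)) + (1 + μc⁻¹ * ∑ i, vz.1 i * Real.log (vz.1 i))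
  have hF : ∀ f, MemLp (F f) 2
      (ρ.prod (Measure.pi fun _ : Fin b => (volume : Measure unitInterval))) :=
    fun f => hlp_full hv hC2 (Lp.memLp f)
  have hFm : ∀ f, Measurable (F f) := by
    intro f
    have : Measurable (f : unitInterval → ℝ) := (Lp.stronglyMeasurable f).measurable
    fun_prop
  let S : Lp ℝ 2 (volume : Measure unitInterval) → Lp ℝ 2 (volume : Measure unitInterval) :=
    fun f => ((hF f).comp_measurePreserving hMP).toLp _
  have hS : ∀ f, S f =ᵐ[volume] F f ∘ Φ := fun f => MemLp.coeFn_toLp _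
  let s : Set (Lp ℝ 2 (volume : Measure unitInterval)) := {f | ∫ ω, f ω = 0}
  have hint : ∀ f : Lp ℝ 2 (volume : Measure unitInterval), Integrable (f : unitInterval → ℝ) :=
    fun f => (Lp.memLp f).integrable (by norm_num)
  have hs : IsClosed s := by
    have hl : LipschitzWith 1 (fun f : Lp ℝ 2 (volume : Measure unitInterval) => ∫ ω, f ω) := by
      refine LipschitzWith.of_dist_le_mul fun f g => ?_
      rw [Real.dist_eq, ← integral_sub (hint f) (hint g), dist_eq_norm, NNReal.coe_one, one_mul]
      have hm : MemLp (fun ω => f ω - g ω) 2 (volume : Measure unitInterval) :=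
        (Lp.memLp f).sub (Lp.memLp g)
      apply abs_le_of_sq_le_sq _ (norm_nonneg _)
      rw [hlp_norm_sq]
      have := ProbabilityTheory.variance_nonneg (fun ω => f ω - g ω)
        (volume : Measure unitInterval)
      rw [ProbabilityTheory.variance_eq_sub hm] at this
      simpa using this
    exact isClosed_eq hl.continuous continuous_const
  have hmaps : Set.MapsTo S s s := by
    intro f hf
    change ∫ ω, S f ω = 0
    rw [integral_congr_ae (hS f)]
    have := integral_map (μ := volume) hΦ.aemeasurable (f := F f)
      (hFm f).aestronglyMeasurable
    rw [hmap] at this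
    exact this.symm.trans (hlp_full_mean hv hC2 hC (Lp.memLp f) hf)
  have hcn : 0 ≤ ∑ k, ∫ v, v k ^ 2 ∂ρ :=
    Finset.sum_nonneg fun k _ => integral_nonneg fun v => sq_nonneg _
  have hkey : ∀ f ∈ s, ∀ g ∈ s, ‖S f - S g‖ ≤ Real.sqrt (∑ k, ∫ v, v k ^ 2 ∂ρ) * ‖f - g‖ := by
    intro f hf g hg
    refine le_of_sq_le_sq ?_ (by positivity)
    rw [mul_pow, Real.sq_sqrt hcn, hlp_norm_sq, hlp_norm_sq]
    have hm : MemLp (fun ω => f ω - g ω) 2 (volume : Measure unitInterval) :=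
      (Lp.memLp f).sub (Lp.memLp g)
    have h0 : ∫ ω, (f ω - g ω) = 0 := by
      rw [integral_sub (hint f) (hint g), show ∫ ω, f ω = 0 from hf,
        show ∫ ω, g ω = 0 from hg, sub_zero]
    rw [← hlp_sq hv hm h0]
    rw [← hmap, integral_map hΦ.aemeasurable]
    · apply le_of_eq
      refine integral_congr_ae ?_
      filter_upwards [hS f, hS g] with ω h1 h2
      rw [h1, h2]
      simp only [F, Function.comp, mul_sub, Finset.sum_sub_distrib]
      ring
    · have h1 : Measurable (f : unitInterval → ℝ) := (Lp.stronglyMeasurable f).measurable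
      have h2 : Measurable (g : unitInterval → ℝ) := (Lp.stronglyMeasurable g).measurable
      exact Measurable.aestronglyMeasurable (by fun_prop)
  have hcontr : ContractingWith (Real.sqrt (∑ k, ∫ v, v k ^ 2 ∂ρ)).toNNReal
      (hmaps.restrict S s s) := by
    refine ⟨?_, LipschitzWith.of_dist_le_mul fun f g => ?_⟩
    · rw [Real.toNNReal_lt_one, Real.sqrt_lt' one_pos]; simpa using hc
    · rw [Real.coe_toNNReal _ (Real.sqrt_nonneg _), Subtype.dist_eq, Subtype.dist_eq, dist_eq_norm, dist_eq_norm]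
      exact hkey f f.2 g g.2
  have h0s : (0 : Lp ℝ 2 (volume : Measure unitInterval)) ∈ s := by
    change ∫ ω, (0 : Lp ℝ 2 (volume : Measure unitInterval)) ω = 0
    rw [integral_congr_ae (Lp.coeFn_zero ℝ 2 volume)]
    simp
  obtain ⟨f, hfs, hfix, -⟩ := hcontr.exists_fixedPoint' hs.isComplete hmaps h0s (edist_ne_top _ _)
  have hfm : Measurable (f : unitInterval → ℝ) := (Lp.stronglyMeasurable f).measurable
  refine ⟨volume.map f, ⟨Measure.isProbabilityMeasure_map hfm.aemeasurable, ?_, ?_⟩, ?_⟩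
  · rw [integral_map hfm.aemeasurable (by fun_prop)]; exact hfs
  · rw [integrable_map_measure (by fun_prop) hfm.aemeasurable]
    exact (Lp.memLp f).integrable_sq
  · rw [hlp_splitOp_map μc hfm, ← hmap]
    change (volume.map Φ).map (F f) = _
    rw [Measure.map_map (hFm f) hΦ]
    refine Measure.map_congr ?_
    have := hS f
    rw [hfix.eq] at this
    exact this.symm

lemma hlp_nonneg (φ ψ : Measure ℝ) : 0 ≤ mallows2 φ ψ := by
  apply Real.sInf_nonneg
  rintro r ⟨π, -, -, -, rfl⟩
  exact Real.rpow_nonneg (integral_nonneg fun p => sq_nonneg _) _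

lemma hlp_memLp {φ : Measure ℝ} (h : Integrable (fun x : ℝ => x ^ 2) φ) : MemLp id 2 φ :=
  (memLp_two_iff_integrable_sq (by fun_prop)).2 h

lemma hlp_diff {φ ψ : Measure ℝ} (h1 : Integrable (fun x : ℝ => x ^ 2) φ)
    (h2 : Integrable (fun x : ℝ => x ^ 2) ψ) {π : Measure (ℝ × ℝ)}
    (hf : π.map Prod.fst = φ) (hs : π.map Prod.snd = ψ) :
    MemLp (fun p : ℝ × ℝ => p.1) 2 π ∧ MemLp (fun p : ℝ × ℝ => p.2) 2 π :=
  ⟨(hlp_memLp h1).comp_measurePreserving ⟨measurable_fst, hf⟩,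
    (hlp_memLp h2).comp_measurePreserving ⟨measurable_snd, hs⟩⟩

lemma hlp_eq {φ ψ : Measure ℝ} [IsProbabilityMeasure φ] [IsProbabilityMeasure ψ]
    (h1 : Integrable (fun x : ℝ => x ^ 2) φ)
    (h2 : Integrable (fun x : ℝ => x ^ 2) ψ) (h : mallows2 φ ψ = 0) : φ = ψ := by
  apply Measure.ext_of_charFun
  ext t
  rw [← sub_eq_zero, ← norm_eq_zero]
  refine le_antisymm (le_of_forall_pos_le_add fun ε hε => ?_) (norm_nonneg _)
  rw [zero_add]
  have hne : {r : ℝ | ∃ π : Measure (ℝ × ℝ), IsProbabilityMeasure π ∧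
    π.map Prod.fst = φ ∧ π.map Prod.snd = ψ ∧
    r = (∫ p, (p.1 - p.2) ^ 2 ∂π) ^ (1/2 : ℝ)}.Nonempty :=
    ⟨_, φ.prod ψ, inferInstance, by simp, by simp, rfl⟩
  have hlt : mallows2 φ ψ < ε / (|t| + 1) := by rw [h]; positivity
  obtain ⟨r, ⟨π, hπ, hf, hs, hr⟩, hrlt⟩ := exists_lt_of_csInf_lt hne hlt
  obtain ⟨m1, m2⟩ := hlp_diff h1 h2 hf hs
  have hm : MemLp (fun p : ℝ × ℝ => p.1 - p.2) 2 π := m1.sub m2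
  have hb : ∫ p, |p.1 - p.2| ∂π ≤ r := by
    rw [hr, ← Real.sqrt_eq_rpow]
    apply Real.le_sqrt_of_sq_le
    have := ProbabilityTheory.variance_nonneg (fun p : ℝ × ℝ => |p.1 - p.2|) π
    rw [ProbabilityTheory.variance_eq_sub (X := fun p : ℝ × ℝ => |p.1 - p.2|) hm.abs] at this
    simpa using this
  have e1 : charFun φ t = ∫ p, Complex.exp (t * p.1 * Complex.I) ∂π := by
    rw [charFun_apply_real, ← hf, integral_map (by fun_prop) (by fun_prop)]
  have e2 : charFun ψ t = ∫ p, Complex.exp (t * p.2 * Complex.I) ∂π := by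
    rw [charFun_apply_real, ← hs, integral_map (by fun_prop) (by fun_prop)]
  have i1 : ∀ g : ℝ × ℝ → ℝ, Measurable g →
      Integrable (fun p => Complex.exp (t * g p * Complex.I)) π := by
    intro g hg
    refine Integrable.of_bound (C := 1) (Measurable.aestronglyMeasurable (by fun_prop)) ?_
    refine Filter.Eventually.of_forall fun p => ?_
    rw [← Complex.ofReal_mul, Complex.norm_exp_ofReal_mul_I]
  rw [e1, e2, ← integral_sub (i1 _ measurable_fst) (i1 _ measurable_snd)]
  calc _ ≤ ∫ p, |t| * |p.1 - p.2| ∂π := by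
        refine norm_integral_le_of_norm_le ((hm.integrable (by norm_num)).abs.const_mul _) ?_
        refine Filter.Eventually.of_forall fun p => ?_
        have : Complex.exp (t * p.1 * Complex.I) - Complex.exp (t * p.2 * Complex.I)
            = Complex.exp ((t * p.2 : ℝ) * Complex.I) *
              (Complex.exp (Complex.I * (t * (p.1 - p.2) : ℝ)) - 1) := by
          rw [mul_sub, ← Complex.exp_add, mul_one]
          push_cast
          ring_nf
        rw [this, norm_mul, Complex.norm_exp_ofReal_mul_I, one_mul, ← abs_mul]
        exact Real.norm_exp_I_mul_ofReal_sub_one_le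
    _ = |t| * ∫ p, |p.1 - p.2| ∂π := integral_const_mul _ _
    _ ≤ |t| * (ε / (|t| + 1)) := by gcongr; linarith
    _ ≤ ε := by
        rw [mul_div_assoc', div_le_iff₀ (by positivity)]
        nlinarith [abs_nonneg t]

lemma hlp_contr (hv : ∀ᵐ v ∂ρ, ∀ i, |v i| ≤ 1) (μc : ℝ) {φ ψ : Measure ℝ}
    [IsProbabilityMeasure φ] [IsProbabilityMeasure ψ]
    (h1 : Integrable (fun x : ℝ => x ^ 2) φ) (h2 : Integrable (fun x : ℝ => x ^ 2) ψ)
    (hφ : ∫ x, x ∂φ = 0) (hψ : ∫ x, x ∂ψ = 0) :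
    mallows2 (splitOp ρ μc φ) (splitOp ρ μc ψ) ≤
      Real.sqrt (∑ k, ∫ v, v k ^ 2 ∂ρ) * mallows2 φ ψ := by
  have hcn : 0 ≤ ∑ k, ∫ v, v k ^ 2 ∂ρ :=
    Finset.sum_nonneg fun k _ => integral_nonneg fun v => sq_nonneg _
  conv_rhs => rw [mallows2, ← smul_eq_mul, ← Real.sInf_smul_of_nonneg (Real.sqrt_nonneg _)]
  refine le_csInf (Set.Nonempty.smul_set
    ⟨_, φ.prod ψ, inferInstance, by simp, by simp, rfl⟩) ?_
  rintro _ ⟨_, ⟨π, hπ, hf, hs, rfl⟩, rfl⟩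
  obtain ⟨m1, m2⟩ := hlp_diff h1 h2 hf hs
  have hm : MemLp (fun p : ℝ × ℝ => p.1 - p.2) 2 π := m1.sub m2
  have h0 : ∫ p, (p.1 - p.2) ∂π = 0 := by
    rw [integral_sub (m1.integrable (by norm_num)) (m2.integrable (by norm_num))]
    have e1 : ∫ p, p.1 ∂π = 0 := by
      rw [← hφ, ← hf, integral_map (by fun_prop) (by fun_prop)]
    have e2 : ∫ p, p.2 ∂π = 0 := by
      rw [← hψ, ← hs, integral_map (by fun_prop) (by fun_prop)]
    rw [e1, e2, sub_zero]
  let G : (ℝ × ℝ → ℝ) → (Fin b → ℝ) × (Fin b → ℝ × ℝ) → ℝ := fun X vz =>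
    (∑ k, vz.1 k * X (vz.2 k)) + (1 + μc⁻¹ * ∑ i, vz.1 i * Real.log (vz.1 i))
  have hG1 : Measurable (G Prod.fst) := by fun_prop
  have hG2 : Measurable (G Prod.snd) := by fun_prop
  refine csInf_le ⟨0, ?_⟩ ⟨(ρ.prod (Measure.pi fun _ : Fin b => π)).map
    (fun vz => (G Prod.fst vz, G Prod.snd vz)),
    Measure.isProbabilityMeasure_map (by fun_prop), ?_, ?_, ?_⟩
  · rintro r ⟨π, -, -, -, rfl⟩
    exact Real.rpow_nonneg (integral_nonneg fun p => sq_nonneg _) _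
  · rw [Measure.map_map measurable_fst (by fun_prop), ← hf, hlp_splitOp_map μc measurable_fst]
    rfl
  · rw [Measure.map_map measurable_snd (by fun_prop), ← hs, hlp_splitOp_map μc measurable_snd]
    rfl
  · rw [integral_map (by fun_prop) (by fun_prop)]
    have : ∀ vz, (G Prod.fst vz - G Prod.snd vz) ^ 2
        = (∑ k, vz.1 k * ((vz.2 k).1 - (vz.2 k).2)) ^ 2 := by
      intro vz
      simp only [G, mul_sub, Finset.sum_sub_distrib]
      ring
    simp only [this]
    rw [hlp_sq (d := fun p : ℝ × ℝ => p.1 - p.2) hv hm h0, ← Real.sqrt_eq_rpow,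
      ← Real.sqrt_eq_rpow, Real.sqrt_mul hcn, smul_eq_mul]

end helpers

/-- Contraction of the operator `T` on the space `𝓜₂⁰` of centered laws with finite
second moment, with Lipschitz constant `√(b·E[V²]) < 1`; consequently `T` has a unique
fixed point in `𝓜₂⁰`. -/
theorem stmt4
    (b : ℕ) (hb : 2 ≤ b) (ρ : Measure (Fin b → ℝ)) [IsProbabilityMeasure ρ]
    (hnonneg : ∀ᵐ v ∂ρ, ∀ i, 0 ≤ v i) (hsum : ∀ᵐ v ∂ρ, ∑ i, v i = 1)
    (hexch : ∀ i : Fin b, ρ.map (fun v => v i) = ρ.map (fun v => v ⟨0, by omega⟩))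
    (μc : ℝ) (hμc : μc = b * ∫ v, -(v ⟨0, by omega⟩ * Real.log (v ⟨0, by omega⟩)) ∂ρ) (hμpos : 0 < μc)
    (hcontr : b * ∫ v, (v ⟨0, by omega⟩) ^ 2 ∂ρ < 1)
    (hsq : Integrable (fun v => (v ⟨0, by omega⟩) ^ 2) ρ)
    (hC2 : Integrable (fun v => (1 + μc⁻¹ * ∑ i, v i * Real.log (v i)) ^ 2) ρ)
    (M20 : Set (Measure ℝ))
    (hM20 : M20 = {φ | IsProbabilityMeasure φ ∧ (∫ x, x ∂φ) = 0 ∧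
      Integrable (fun x : ℝ => x ^ 2) φ}) :
    (∀ φ ψ, φ ∈ M20 → ψ ∈ M20 →
      mallows2 (splitOp ρ μc φ) (splitOp ρ μc ψ) ≤
        Real.sqrt (b * ∫ v, (v ⟨0, by omega⟩) ^ 2 ∂ρ) * mallows2 φ ψ) ∧
    (∃! φ, φ ∈ M20 ∧ splitOp ρ μc φ = φ) := by
  have hb0 : 0 < b := by omega
  have hv : ∀ᵐ v ∂ρ, ∀ i, |v i| ≤ 1 := by
    filter_upwards [hnonneg, hsum] with v h1 h2 i
    rw [abs_of_nonneg (h1 i), ← h2]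
    exact Finset.single_le_sum (fun j _ => h1 j) (Finset.mem_univ i)
  have hmarg : ∀ (g : ℝ → ℝ), Measurable g → ∀ i : Fin b,
      ∫ v, g (v i) ∂ρ = ∫ v, g (v ⟨0, hb0⟩) ∂ρ := by
    intro g hg i
    rw [← integral_map (μ := ρ) (φ := fun v => v i) (measurable_pi_apply _).aemeasurable hg.aestronglyMeasurable,
      hexch i, integral_map (measurable_pi_apply _).aemeasurable hg.aestronglyMeasurable]
  have hsumsq : ∑ k, ∫ v, v k ^ 2 ∂ρ = b * ∫ v, (v ⟨0, hb0⟩) ^ 2 ∂ρ := by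
    rw [Finset.sum_congr rfl fun k _ => hmarg (fun x => x ^ 2) (by fun_prop) k]
    simp
  have hlogint : ∀ i : Fin b, Integrable (fun v : Fin b → ℝ => v i * Real.log (v i)) ρ := by
    intro i
    refine Integrable.of_bound (C := 1) (Measurable.aestronglyMeasurable (by fun_prop)) ?_
    filter_upwards [hnonneg, hv] with v h1 h2
    rcases (h1 i).eq_or_lt with h | h
    · rw [← h]; simp
    · rw [mul_comm]
      exact (Real.abs_log_mul_self_lt _ h (le_of_abs_le (h2 i))).le
  have hC : ∫ v, (1 + μc⁻¹ * ∑ i, v i * Real.log (v i)) ∂ρ = 0 := by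
    rw [integral_add (integrable_const _)
      ((integrable_finsetSum _ fun i _ => hlogint i).const_mul _), integral_const_mul,
      integral_finsetSum _ fun i _ => hlogint i,
      Finset.sum_congr rfl fun k _ => hmarg (fun x => x * Real.log x) (by fun_prop) k]
    rw [integral_neg] at hμc
    have h3 : (b : ℝ) * ∫ v, v ⟨0, hb0⟩ * Real.log (v ⟨0, hb0⟩) ∂ρ = -μc := by
      rw [hμc]; ring
    simp only [Finset.sum_const, Finset.card_univ, Fintype.card_fin, nsmul_eq_mul, h3]
    simp [hμpos.ne']
  have hK : ∀ φ ψ, φ ∈ M20 → ψ ∈ M20 →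
      mallows2 (splitOp ρ μc φ) (splitOp ρ μc ψ) ≤
        Real.sqrt (b * ∫ v, (v ⟨0, by omega⟩) ^ 2 ∂ρ) * mallows2 φ ψ := by
    subst hM20
    rintro φ ψ ⟨_, a2, a3⟩ ⟨_, b2, b3⟩
    rw [← hsumsq]
    exact hlp_contr hv μc a3 b3 a2 b2
  refine ⟨hK, ?_⟩
  obtain ⟨φ, hφ, hfix⟩ := hlp_fixed hv hC2 hC (hsumsq ▸ hcontr)
  have hφM : φ ∈ M20 := by rw [hM20]; exact hφ
  refine ⟨φ, ⟨hφM, hfix⟩, ?_⟩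
  rintro ψ ⟨hψM, hψfix⟩
  have h := hK ψ φ hψM hφM
  rw [hfix, hψfix] at h
  have hlt : Real.sqrt (b * ∫ v, (v ⟨0, hb0⟩) ^ 2 ∂ρ) < 1 := by
    rw [Real.sqrt_lt' one_pos]; simpa using hcontr
  have hz : mallows2 ψ φ = 0 := by
    have := hlp_nonneg ψ φ
    nlinarith
  rw [hM20] at hψM
  obtain ⟨_, _, h3⟩ := hψM
  obtain ⟨_, _, h4⟩ := hφ
  exact hlp_eq h3 h4 hz
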